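/- Let L_1, …, L_n be simple closure spaces, L_i on Σ_i, each of which is a DAC-lattice. If ∧○_{i=1}^n L_i = ∨○_{i=1}^n L_i, then there is at most one index i with L_i ≠ 2^{Σ_i}. -/

import Mathlib

open Set

namespace QLTensor

universe u v w

/-- A simple closure space on `X`: a set of subsets of `X`, closed under arbitrary
set-intersections, containing `∅`, `univ` and all singletons. -/
def IsSCS {X : Type*} (L : Set (Set X)) : Prop :=
  (∀ ω ⊆ L, ⋂₀ ω ∈ L) ∧ ∅ ∈ L ∧ Set.univ ∈ L ∧ ∀ p : X, ({p} : Set X) ∈ L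

/-- The join in a simple closure space: `⋁ A = ⋂ {b ∈ L | A ⊆ b}`. -/
def cl {X : Type*} (L : Set (Set X)) (A : Set X) : Set X :=
  ⋂₀ {b | b ∈ L ∧ A ⊆ b}

/-- `b` covers `a` in the lattice `L` (both belonging to `L`). -/
def CoversIn {X : Type*} (L : Set (Set X)) (a b : Set X) : Prop :=
  a ∈ L ∧ b ∈ L ∧ a ⊂ b ∧ ∀ c ∈ L, a ⊂ c → c ⊂ b → False

/-- `x` is a coatom of `L` (covered by the top element `univ`). -/
def IsCoatomIn {X : Type*} (L : Set (Set X)) (x : Set X) : Prop :=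
  x ∈ L ∧ x ≠ Set.univ ∧ ∀ c ∈ L, x ⊂ c → c = Set.univ

/-- `L` is coatomistic: every element is an intersection of coatoms. -/
def Coatomistic {X : Type*} (L : Set (Set X)) : Prop :=
  ∀ a ∈ L, a = ⋂₀ {x | IsCoatomIn L x ∧ a ⊆ x}

/-- The covering property: if `p ∧ a = 0` then `p ∨ a` covers `a`. -/
def CovProp {X : Type*} (L : Set (Set X)) : Prop :=
  ∀ p : X, ∀ a ∈ L, p ∉ a → CoversIn L a (cl L (insert p a))

/-- The covering property of the dual lattice. -/
def DualCovProp {X : Type*} (L : Set (Set X)) : Prop :=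
  ∀ x : Set X, IsCoatomIn L x → ∀ a ∈ L, cl L (a ∪ x) = Set.univ →
    CoversIn L (a ∩ x) a

/-- A DAC-lattice: `L` and its dual are atomistic with the covering property
(a simple closure space is automatically atomistic). -/
def IsDAC {X : Type*} (L : Set (Set X)) : Prop :=
  CovProp L ∧ Coatomistic L ∧ DualCovProp L

/-- `(a, b)` is a modular pair: `(c ∨ a) ∧ b = c ∨ (a ∧ b)` for all `c ≤ b`. -/
def ModularPairIn {X : Type*} (L : Set (Set X)) (a b : Set X) : Prop :=
  ∀ c ∈ L, c ⊆ b → cl L (c ∪ a) ∩ b = cl L (c ∪ a ∩ b)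

/-- `z` is a central element of the simple closure space `L`. -/
def IsCentralIn {X : Type*} (L : Set (Set X)) (z : Set X) : Prop :=
  zᶜ ∈ L ∧ ModularPairIn L z zᶜ ∧ ModularPairIn L zᶜ z

/-- `L` is irreducible: its only central elements are `∅` and `univ`. -/
def IrreducibleSCS {X : Type*} (L : Set (Set X)) : Prop :=
  ∀ z ∈ L, IsCentralIn L z → z = ∅ ∨ z = Set.univ

/-- `N` is an orthocomplementation of the simple closure space `L`. -/
def IsOrtho {X : Type*} (L : Set (Set X)) (N : Set X → Set X) : Prop :=
  (∀ a ∈ L, N a ∈ L) ∧ (∀ a ∈ L, N (N a) = a) ∧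
  (∀ a ∈ L, ∀ b ∈ L, a ⊆ b → N b ⊆ N a) ∧
  ∀ a ∈ L, cl L (a ∪ N a) = Set.univ

/-- `L` with orthocomplementation `N` is orthomodular. -/
def OrthomodularIn {X : Type*} (L : Set (Set X)) (N : Set X → Set X) : Prop :=
  ∀ a ∈ L, ∀ b ∈ L, a ⊆ b → b = cl L (a ∪ b ∩ N a)

/-- `L` contains `MO₃`. -/
def ContainsMO3 {X : Type*} (L : Set (Set X)) : Prop :=
  ∃ p q r : X, p ≠ q ∧ p ≠ r ∧ q ≠ r ∧
    CoversIn L {p} (cl L {p, q}) ∧ CoversIn L {q} (cl L {p, q}) ∧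
    CoversIn L {r} (cl L {p, q})

/-- `L` contains `MO₄`. -/
def ContainsMO4 {X : Type*} (L : Set (Set X)) : Prop :=
  ∃ p₁ p₂ p₃ p₄ : X,
    p₁ ≠ p₂ ∧ p₁ ≠ p₃ ∧ p₁ ≠ p₄ ∧ p₂ ≠ p₃ ∧ p₂ ≠ p₄ ∧ p₃ ≠ p₄ ∧
    CoversIn L {p₁} (cl L {p₁, p₄}) ∧ CoversIn L {p₂} (cl L {p₁, p₄}) ∧
    CoversIn L {p₃} (cl L {p₁, p₄}) ∧ CoversIn L {p₄} (cl L {p₁, p₄})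

/-- `L` is connected. -/
def ConnectedSCS {X : Type*} (L : Set (Set X)) : Prop :=
  (∃ p q : X, p ≠ q) ∧
  ∀ p q : X, p ≠ q → ∃ r : X, r ≠ p ∧ r ≠ q ∧ r ∈ cl L {p, q} ∧
    p ∈ cl L {q, r} ∧ q ∈ cl L {p, r}

/-- `L` is weakly connected: `L ≠ 2` and the point set admits a connected covering. -/
def WeaklyConnected {X : Type*} (L : Set (Set X)) : Prop :=
  (∃ p q : X, p ≠ q) ∧
  ∃ 𝒜 : Set (Set X),
    ⋃₀ 𝒜 = Set.univ ∧
    (∀ A ∈ 𝒜, ∃ p ∈ A, ∃ q ∈ A, p ≠ q) ∧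
    (∀ A ∈ 𝒜, ∀ p ∈ A, ∀ q ∈ A, p ≠ q → ∃ r, r ≠ p ∧ r ≠ q ∧ r ∈ cl L {p, q}) ∧
    ∀ p q : X, ∃ (m : ℕ) (c : Fin (m + 1) → Set X),
      (∀ i, c i ∈ 𝒜) ∧ p ∈ c 0 ∧ q ∈ c (Fin.last m) ∧
      ∀ i : Fin m, ∃ x ∈ c i.castSucc ∩ c i.succ, ∃ y ∈ c i.castSucc ∩ c i.succ, x ≠ y

/-- The central cover `e(p)` of an atom `p`. -/
def centralCover {X : Type*} (L : Set (Set X)) (p : X) : Set X :=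
  ⋂₀ {z | z ∈ L ∧ IsCentralIn L z ∧ p ∈ z}

/-- The interval `[0, e]` of `L`, viewed as a simple closure space on `e`. -/
def restrictSCS {X : Type*} (L : Set (Set X)) (e : Set X) : Set (Set ↥e) :=
  {B | Subtype.val '' B ∈ L}

/-- The automorphism group of `M` acts transitively on points. -/
def TransitiveSCS {X : Type*} (M : Set (Set X)) : Prop :=
  ∀ p q : X, ∃ u : X ≃ X, (∀ a : Set X, a ∈ M ↔ u '' a ∈ M) ∧ u p = q

section Pi

variable {Ω : Type*} {σ : Ω → Type*}

/-- `⋃_α π_α⁻¹ (a α)`. -/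
def unionCyl (a : ∀ α, Set (σ α)) : Set (∀ α, σ α) :=
  {p | ∃ α, p α ∈ a α}

/-- `∏_α a_α`. -/
def prodSet (a : ∀ α, Set (σ α)) : Set (∀ α, σ α) :=
  {p | ∀ α, p α ∈ a α}

/-- `p[A, β]`. -/
def cylSet (p : ∀ α, σ α) (β : Ω) (A : Set (σ β)) : Set (∀ α, σ α) :=
  {q | q β ∈ A ∧ ∀ α, α ≠ β → q α = p α}

/-- `R_β[p]`. -/
def secSet (R : Set (∀ α, σ α)) (β : Ω) (p : ∀ α, σ α) : Set (σ β) :=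
  {x | ∃ q ∈ R, q β = x ∧ ∀ α, α ≠ β → q α = p α}

/-- The separated product `∧○_α L_α`. -/
def wedgeO (L : ∀ α, Set (Set (σ α))) : Set (Set (∀ α, σ α)) :=
  {S | ∃ ω : Set (Set (∀ α, σ α)),
    (∀ y ∈ ω, ∃ a : ∀ α, Set (σ α), (∀ α, a α ∈ L α) ∧ y = unionCyl a) ∧ S = ⋂₀ ω}

/-- The product `∨○_α L_α`. -/
def veeO (L : ∀ α, Set (Set (σ α))) : Set (Set (∀ α, σ α)) :=
  {R | ∀ (β : Ω) (p : ∀ α, σ α), secSet R β p ∈ L β}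

/-- Axiom P2. -/
def AxiomP2 (L : ∀ α, Set (Set (σ α))) (M : Set (Set (∀ α, σ α))) : Prop :=
  ∀ a : ∀ α, Set (σ α), (∀ α, a α ∈ L α) → unionCyl a ∈ M

/-- Axiom P3. -/
def AxiomP3 (L : ∀ α, Set (Set (σ α))) (M : Set (Set (∀ α, σ α))) : Prop :=
  ∀ (p : ∀ α, σ α) (β : Ω) (A : Set (σ β)), cylSet p β A ∈ M → A ∈ L β

/-- `M` is a weak tensor product of the family `L`, i.e. `M ∈ S(L_α, α ∈ Ω)`. -/
def IsWTP (L : ∀ α, Set (Set (σ α))) (M : Set (Set (∀ α, σ α))) : Prop :=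
  IsSCS M ∧ AxiomP2 L M ∧ AxiomP3 L M

/-- `p # q` iff `p_β ⊥_β q_β` for some `β`. -/
def hashRel (N : ∀ α, Set (σ α) → Set (σ α)) (p q : ∀ α, σ α) : Prop :=
  ∃ β, p β ∈ N β {q β}

/-- `R^#`. -/
def sharp (N : ∀ α, Set (σ α) → Set (σ α)) (R : Set (∀ α, σ α)) :
    Set (∀ α, σ α) :=
  {q | ∀ p ∈ R, hashRel N q p}

/-- A join-preserving map `u` is large. -/
def LargeMap (u : Set (∀ α, σ α) → Set (∀ α, σ α)) : Prop :=
  ∀ (β : Ω) (p : ∀ α, σ α),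
    (¬ ∃ x, u (cylSet p β Set.univ) = {x}) ∧ ¬ u Set.univ ⊆ {q | q β = p β}

end Pi

section Binary

variable {X Y : Type*}

/-- The binary product `L₁ ∨○ L₂`. -/
def veeO2 (L1 : Set (Set X)) (L2 : Set (Set Y)) : Set (Set (X × Y)) :=
  {R | (∀ y : Y, {x | (x, y) ∈ R} ∈ L1) ∧ ∀ x : X, {y | (x, y) ∈ R} ∈ L2}

/-- The binary separated product `L₁ ∧○ L₂`. -/
def wedgeO2 (L1 : Set (Set X)) (L2 : Set (Set Y)) : Set (Set (X × Y)) :=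
  {S | ∃ ω : Set (Set (X × Y)),
    (∀ y ∈ ω, ∃ a₁ ∈ L1, ∃ a₂ ∈ L2,
      y = a₁ ×ˢ (Set.univ : Set Y) ∪ (Set.univ : Set X) ×ˢ a₂) ∧
    S = ⋂₀ ω}

end Binary

theorem IsSCS.inter_mem {X : Type*} {L : Set (Set X)} (hL : IsSCS L) {a b : Set X}
    (ha : a ∈ L) (hb : b ∈ L) : a ∩ b ∈ L := by
  rw [← Set.sInter_pair]
  exact hL.1 _ (by rintro c (rfl | rfl) <;> assumption)

theorem IsSCS.cl_mem {X : Type*} {L : Set (Set X)} (hL : IsSCS L) (A : Set X) : cl L A ∈ L :=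
  hL.1 _ fun _ h => h.1

theorem subset_cl {X : Type*} (L : Set (Set X)) (A : Set X) : A ⊆ cl L A :=
  fun _ hx _ hb => hb.2 hx

theorem IsSCS.mem_of_subsingleton {X : Type*} {L : Set (Set X)} (hL : IsSCS L) {A : Set X}
    (hA : A.Subsingleton) : A ∈ L := by
  rcases hA.eq_empty_or_singleton with rfl | ⟨x, rfl⟩
  · exact hL.2.1
  · exact hL.2.2.2 x

/-- A coatomistic simple closure space in which every coatom omits at most one point is the
whole power set. -/
theorem eq_univ_of_compl_coatom_subsingleton {X : Type*} {L : Set (Set X)} (hL : IsSCS L)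
    (hco : Coatomistic L) (h : ∀ x, IsCoatomIn L x → xᶜ.Subsingleton) : L = Set.univ := by
  have compl_mem : ∀ p : X, ({p}ᶜ : Set X) ∈ L := by
    intro p
    have hp : p ∉ ⋂₀ {x | IsCoatomIn L x ∧ ∅ ⊆ x} := by
      rw [← hco ∅ hL.2.1]
      exact Set.notMem_empty p
    simp only [Set.mem_sInter, not_forall] at hp
    obtain ⟨x, hx, hpx⟩ := hp
    have : xᶜ = {p} := (h x hx.1).eq_singleton_of_mem hpx
    rw [← this, compl_compl]
    exact hx.1.1
  refine Set.eq_univ_of_forall fun A => ?_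
  have : A = ⋂₀ ((fun p => ({p}ᶜ : Set X)) '' Aᶜ) := by
    ext y
    simp only [Set.sInter_image, Set.mem_iInter, Set.mem_compl_iff, Set.mem_singleton_iff]
    exact ⟨fun hy p hp hyp => hp (hyp ▸ hy), fun hy => by_contra fun hyA => hy y hyA rfl⟩
  rw [this]
  refine hL.1 _ ?_
  rintro _ ⟨p, -, rfl⟩
  exact compl_mem p

/-- In a simple closure space with the covering property, two distinct points of a line
span that line. -/
theorem cl_pair_subset_of_mem {X : Type*} {L : Set (Set X)} (hL : IsSCS L) (hcov : CovProp L)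
    {p q r : X} (hpq : p ≠ q) (hqr : q ≠ r) (hr : r ∈ cl L {p, q}) {a : Set X} (ha : a ∈ L)
    (hqa : q ∈ a) (hra : r ∈ a) : cl L {p, q} ⊆ a := by
  obtain ⟨-, -, -, hc⟩ := hcov p {q} (hL.2.2.2 q) hpq
  by_contra hsub
  refine hc (a ∩ cl L {p, q}) (hL.inter_mem ha (hL.cl_mem _)) ?_ ?_
  · refine (Set.ssubset_iff_of_subset ?_).2 ⟨r, ⟨hra, hr⟩, fun h => hqr h.symm⟩
    rintro _ rfl
    exact ⟨hqa, subset_cl L _ (by simp)⟩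
  · exact ⟨Set.inter_subset_right, fun h => hsub fun y hy => (h hy).1⟩

/-- A DAC-lattice which is not a power set has a line with three distinct points. -/
theorem exists_three_points_on_line {X : Type*} {L : Set (Set X)} (hL : IsSCS L) (hdac : IsDAC L)
    (hne : L ≠ Set.univ) : ∃ t : Fin 3 → X, Function.Injective t ∧
      ∀ a ∈ L, ∀ k l m : Fin 3, k ≠ l → t k ∈ a → t l ∈ a → t m ∈ a := by
  obtain ⟨hcov, hco, hdual⟩ := hdac
  have : ∃ x, IsCoatomIn L x ∧ ¬ xᶜ.Subsingleton := by
    by_contra! h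
    exact hne (eq_univ_of_compl_coatom_subsingleton hL hco h)
  obtain ⟨x, hx, hsub⟩ := this
  obtain ⟨p, hp, q, hq, hpq⟩ := Set.not_subsingleton_iff.1 hsub
  have hpl : p ∈ cl L {p, q} := subset_cl L _ (by simp)
  have hql : q ∈ cl L {p, q} := subset_cl L _ (by simp)
  have htop : cl L (cl L {p, q} ∪ x) = Set.univ := by
    refine hx.2.2 _ (hL.cl_mem _) ((Set.ssubset_iff_of_subset ?_).2 ⟨p, ?_, hp⟩)
    · exact Set.subset_union_right.trans (subset_cl L _)
    · exact subset_cl L _ (Or.inl hpl)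
  obtain ⟨-, -, -, hc⟩ := hdual x hx _ (hL.cl_mem _) htop
  have hmeet : (cl L {p, q} ∩ x).Nonempty := by
    by_contra hempty
    rw [Set.not_nonempty_iff_eq_empty] at hempty
    rw [hempty] at hc
    refine hc {p} (hL.2.2.2 p) (Set.empty_ssubset.2 (Set.singleton_nonempty p)) ?_
    exact (Set.ssubset_iff_of_subset (Set.singleton_subset_iff.2 hpl)).2
      ⟨q, hql, fun h => hpq h.symm⟩
  obtain ⟨r, hrl, hrx⟩ := hmeet
  have hpr : p ≠ r := fun h => hp (h ▸ hrx)
  have hqr : q ≠ r := fun h => hq (h ▸ hrx)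
  have hpqr : ∀ a ∈ L, p ∈ a → q ∈ a → r ∈ a := fun a ha h1 h2 =>
    hrl a ⟨ha, by rintro _ (rfl | rfl) <;> assumption⟩
  have hqrp : ∀ a ∈ L, q ∈ a → r ∈ a → p ∈ a := fun a ha h1 h2 =>
    cl_pair_subset_of_mem hL hcov hpq hqr hrl ha h1 h2 hpl
  have hprq : ∀ a ∈ L, p ∈ a → r ∈ a → q ∈ a := fun a ha h1 h2 => by
    rw [Set.pair_comm] at hrl hql
    exact cl_pair_subset_of_mem hL hcov hpq.symm hpr hrl ha h1 h2 hql
  refine ⟨![p, q, r], ?_, ?_⟩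
  · intro k l hkl
    fin_cases k <;> fin_cases l <;> simp_all
  · intro a ha k l m hkl hk hl
    have h1 := hpqr a ha
    have h2 := hqrp a ha
    have h3 := hprq a ha
    fin_cases k <;> fin_cases l <;> fin_cases m <;> simp_all

/-- for DAC-lattices `L₁, …, L_n`, if `∧○_i L_i = ∨○_i L_i`, then at most
one index has `L_i ≠ 2^{Σ_i}`. -/
theorem stmt8 {n : ℕ} {σ : Fin n → Type*} [∀ i, Nonempty (σ i)]
    (L : ∀ i, Set (Set (σ i))) (hL : ∀ i, IsSCS (L i)) (hdac : ∀ i, IsDAC (L i))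
    (heq : wedgeO L = veeO L) :
    ∀ i j : Fin n, L i ≠ (Set.univ : Set (Set (σ i))) →
      L j ≠ (Set.univ : Set (Set (σ j))) → i = j := by
  intro i j hi hj
  by_contra hij
  obtain ⟨t, ht, htL⟩ := exists_three_points_on_line (hL i) (hdac i) hi
  obtain ⟨u, hu, huL⟩ := exists_three_points_on_line (hL j) (hdac j) hj
  let s : ∀ α, σ α := fun α => Classical.arbitrary (σ α)
  let P : Fin 3 → Fin 3 → ∀ α, σ α := fun k l =>
    Function.update (Function.update s i (t k)) j (u l)
  have Pi : ∀ k l, P k l i = t k := fun k l => by simp [P, hij]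
  have Pj : ∀ k l, P k l j = u l := fun k l => by simp [P]
  have Pother : ∀ k l α, α ≠ i → α ≠ j → P k l α = s α := fun k l α h1 h2 => by simp [P, h1, h2]
  have hvee : Set.range (fun k => P k k) ∈ veeO L := by
    intro β v
    refine (hL β).mem_of_subsingleton ?_
    rintro _ ⟨_, ⟨k, rfl⟩, rfl, hk⟩ _ ⟨_, ⟨l, rfl⟩, rfl, hl⟩
    have hkl : k = l := by
      by_cases hβ : i = β
      · have hjβ : j ≠ β := fun h => hij (hβ.trans h.symm)
        have h := (hk j hjβ).trans (hl j hjβ).symm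
        exact hu (by simpa only [Pj] using h)
      · have h := (hk i hβ).trans (hl i hβ).symm
        exact ht (by simpa only [Pi] using h)
    rw [hkl]
  rw [← heq] at hvee
  obtain ⟨ω, hω, hR⟩ := hvee
  have hmem : P 0 1 ∈ Set.range (fun k => P k k) := by
    rw [hR]
    intro y hy
    have hsub : ∀ k, P k k ∈ y := fun k => by
      have : P k k ∈ ⋂₀ ω := hR ▸ Set.mem_range_self k
      exact this y hy
    obtain ⟨a, ha, rfl⟩ := hω y hy
    by_cases hs : ∃ α, α ≠ i ∧ α ≠ j ∧ s α ∈ a α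
    · obtain ⟨α, h1, h2, h3⟩ := hs
      exact ⟨α, by rwa [Pother _ _ α h1 h2]⟩
    have hcase : ∀ k, t k ∈ a i ∨ u k ∈ a j := by
      intro k
      obtain ⟨α, hα⟩ := hsub k
      by_cases h1 : α = i
      · subst h1
        exact Or.inl (by rwa [Pi] at hα)
      by_cases h2 : α = j
      · subst h2
        exact Or.inr (by rwa [Pj] at hα)
      rw [Pother _ _ α h1 h2] at hα
      exact absurd ⟨α, h1, h2, hα⟩ hs
    have htwo : t 0 ∈ a i ∨ u 1 ∈ a j := by
      have h1 := htL _ (ha i) 1 2 0 (by decide)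
      have h2 := huL _ (ha j) 0 2 1 (by decide)
      have := hcase 0
      have := hcase 1
      have := hcase 2
      tauto
    rcases htwo with h | h
    · exact ⟨i, by rwa [Pi]⟩
    · exact ⟨j, by rwa [Pj]⟩
  obtain ⟨k, hk⟩ := hmem
  have h0 : k = 0 := ht (by simpa only [Pi] using congrFun hk i)
  have h1 : k = 1 := hu (by simpa only [Pj] using congrFun hk j)
  exact absurd (h0.symm.trans h1) (by decide)

end QLTensor
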